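/- The Klee-Walkup polytope realization Q̃₄ = {x ∈ ℝ⁴ : A_Q x ≥ b_Q} is a 4-dimensional polytope with exactly 27 vertices, and its graph diameter (the maximum over pairs of vertices of the minimum length of an edge walk between them) equals 5. -/

import Mathlib

open Matrix

noncomputable section

/-- `F` is a face of `P` of dimension `d`: a nonempty convex extreme subset of `P`
whose affine span has dimension `d`. -/
def IsFaceOfDim {n : ℕ} (P F : Set (Fin n → ℝ)) (d : ℕ) : Prop :=
  F.Nonempty ∧ Convex ℝ F ∧ IsExtreme ℝ P F ∧
    Module.finrank ℝ (affineSpan ℝ F).direction = d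

/-- An edge walk of length `k` between vertices `u` and `v` of `P`: a sequence of vertices
`u = y⁰, …, yᵏ = v` such that each segment `[yⁱ, y^{i+1}]` is an edge (1-dimensional face)
of `P`. -/
def IsEdgeWalk {n : ℕ} (P : Set (Fin n → ℝ)) (k : ℕ) (u v : Fin n → ℝ) : Prop :=
  ∃ y : Fin (k + 1) → (Fin n → ℝ),
    y 0 = u ∧ y (Fin.last k) = v ∧ (∀ i, y i ∈ Set.extremePoints ℝ P) ∧
    ∀ i : Fin k, IsFaceOfDim P (segment ℝ (y i.castSucc) (y i.succ)) 1
/-- The constraint matrix of the Klee–Walkup polytope realization `Q̃₄`. -/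
def AQ : Matrix (Fin 9) (Fin 4) ℝ :=
  !![3, -3, -1, -2;
     -3, 3, -1, -2;
     -2, 1, -1, -3;
     2, -1, -1, -3;
     -3, -3, 1, -2;
     3, 3, 1, -2;
     1, 2, 1, -3;
     -1, -2, 1, -3;
     0, 0, 0, 2]

/-- The right-hand side of the Klee–Walkup polytope realization `Q̃₄`. -/
def bQ : Fin 9 → ℝ := fun _ => -1

/-- The polytope `Q̃₄`. -/
def polyQ : Set (Fin 4 → ℝ) := {x | ∀ i, bQ i ≤ AQ.mulVec x i}

section Polyhedron

variable {ι κ : Type*} {n : ℕ} {A : Matrix ι (Fin n) ℝ} {b : ι → ℝ}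

/-- The polyhedron cut out by the inequalities `A x ≥ b`. -/
def polyhedron (A : Matrix ι (Fin n) ℝ) (b : ι → ℝ) : Set (Fin n → ℝ) :=
  {x | ∀ i, b i ≤ (A *ᵥ x) i}

theorem isExtreme_polyhedron_face (f : κ → ι) (s : Set κ) :
    IsExtreme ℝ (polyhedron A b)
      {x | x ∈ polyhedron A b ∧ ∀ k ∈ s, (A *ᵥ x) (f k) = b (f k)} := by
  refine ⟨fun x hx => hx.1, ?_⟩
  rintro x hx y hy _ ⟨-, hz⟩ ⟨α, β, hα, hβ, hαβ, rfl⟩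
  refine ⟨hx, fun k hk => ?_⟩
  have hk := hz k hk
  simp only [mulVec_add, mulVec_smul, Pi.add_apply, Pi.smul_apply, smul_eq_mul] at hk
  have hbx := hx (f k)
  have hby := hy (f k)
  obtain rfl : β = 1 - α := by linarith
  have : α * ((A *ᵥ x) (f k) - b (f k)) ≤ 0 := by
    nlinarith [mul_nonneg hβ.le (sub_nonneg.2 hby)]
  have := nonpos_of_mul_nonpos_right this hα
  linarith

theorem mem_extremePoints_polyhedron {x : Fin n → ℝ} (hx : x ∈ polyhedron A b) (f : κ → ι)
    (hxf : ∀ k, (A *ᵥ x) (f k) = b (f k))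
    (hf : ∀ d : Fin n → ℝ, (∀ k, (A *ᵥ d) (f k) = 0) → d = 0) :
    x ∈ Set.extremePoints ℝ (polyhedron A b) := by
  refine mem_extremePoints_iff_left.2 ⟨hx, fun y hy z hz hxyz => ?_⟩
  have := (isExtreme_polyhedron_face f Set.univ).left_mem_of_mem_openSegment hy hz
    ⟨hx, fun k _ => hxf k⟩ hxyz
  refine sub_eq_zero.1 (hf _ fun k => ?_)
  simp [mulVec_sub, hxf, this.2 k trivial]

/-- From a point of a polyhedron one can move a little both ways in any direction that keeps the
active constraints active. -/
theorem exists_pos_add_smul_mem_polyhedron [Finite ι] {x d : Fin n → ℝ} (hx : x ∈ polyhedron A b)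
    (hd : ∀ i, (A *ᵥ x) i = b i → (A *ᵥ d) i = 0) :
    ∃ t : ℝ, 0 < t ∧ x + t • d ∈ polyhedron A b ∧ x - t • d ∈ polyhedron A b := by
  have h : ∀ᶠ t : ℝ in nhds 0, ∀ i, b i ≤ (A *ᵥ x) i + t * (A *ᵥ d) i := by
    refine Filter.eventually_all.2 fun i => ?_
    rcases (hx i).eq_or_lt with hi | hi
    · simp [hd i hi.symm, hi]
    · have hc : ContinuousAt (fun t : ℝ => (A *ᵥ x) i + t * (A *ᵥ d) i) 0 := by fun_prop
      filter_upwards [hc.eventually_const_lt (u := b i) (by simpa using hi)] with t ht using ht.le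
  obtain ⟨ε, hε, h⟩ := Metric.eventually_nhds_iff.1 h
  refine ⟨ε / 2, half_pos hε, fun i => ?_, fun i => ?_⟩
  · simpa [mulVec_add, mulVec_smul] using
      h (y := ε / 2) (by simp [abs_of_pos hε, hε]) i
  · simpa [mulVec_sub, mulVec_smul, ← sub_eq_add_neg] using
      h (y := -(ε / 2)) (by simp [abs_of_pos hε, hε]) i

theorem eq_zero_of_mem_extremePoints_polyhedron [Finite ι] {x d : Fin n → ℝ}
    (hx : x ∈ Set.extremePoints ℝ (polyhedron A b))
    (hd : ∀ i, (A *ᵥ x) i = b i → (A *ᵥ d) i = 0) : d = 0 := by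
  obtain ⟨t, ht, h₁, h₂⟩ := exists_pos_add_smul_mem_polyhedron hx.1 hd
  have := hx.2 h₁ h₂ ⟨1 / 2, 1 / 2, by norm_num, by norm_num, by norm_num, by module⟩
  simpa [ht.ne'] using this

/-- Every vertex of a polyhedron is the unique solution of a square system of active constraints. -/
theorem exists_strictMono_det_ne_zero {m : ℕ} {A : Matrix (Fin m) (Fin n) ℝ} {b : Fin m → ℝ}
    {x : Fin n → ℝ} (hx : x ∈ Set.extremePoints ℝ (polyhedron A b)) :
    ∃ f : Fin n → Fin m, StrictMono f ∧ (A.submatrix f id).det ≠ 0 ∧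
      ∀ k, (A *ᵥ x) (f k) = b (f k) := by
  let B : Matrix {i // (A *ᵥ x) i = b i} (Fin n) ℝ := A.submatrix Subtype.val id
  have hker : LinearMap.ker B.mulVecLin = ⊥ := LinearMap.ker_eq_bot'.2 fun d hd =>
    eq_zero_of_mem_extremePoints_polyhedron hx fun i hi => congr_fun hd ⟨i, hi⟩
  have hrank : B.rank = n := by
    have h := B.mulVecLin.finrank_range_add_finrank_ker
    rwa [hker, finrank_bot, add_zero, Module.finrank_fin_fun] at h
  obtain ⟨κ, a, ha, hspan, hli⟩ := exists_linearIndependent' ℝ B.row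
  have : Finite κ := Finite.of_injective a ha
  have := Fintype.ofFinite κ
  have hcard : Fintype.card κ = n := by
    rw [← finrank_span_eq_card hli, hspan, ← rank_eq_finrank_span_row, hrank]
  let g : κ ↪ Fin m := ⟨fun k => (a k).1, Subtype.val_injective.comp ha⟩
  have hT : (Finset.univ.map g).card = n := by simpa using hcard
  have hmem (k : Fin n) : ∃ l, g l = (Finset.univ.map g).orderEmbOfFin hT k := by
    obtain ⟨l, -, hl⟩ := Finset.mem_map.1 ((Finset.univ.map g).orderEmbOfFin_mem hT k)
    exact ⟨l, hl⟩
  choose c hc using hmem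
  refine ⟨_, ((Finset.univ.map g).orderEmbOfFin hT).strictMono, ?_, fun k => ?_⟩
  · have hcinj : Function.Injective c := fun k l h =>
      ((Finset.univ.map g).orderEmbOfFin hT).injective (by rw [← hc, ← hc, h])
    have := hli.comp c hcinj
    refine ((isUnit_iff_isUnit_det _).1 (linearIndependent_rows_iff_isUnit.1 ?_)).ne_zero
    have hrow : (A.submatrix ((Finset.univ.map g).orderEmbOfFin hT) id).row =
        (B.row ∘ a) ∘ c := by
      ext k j
      simp [← hc, g, B]
    rwa [hrow]
  · rw [← hc]
    exact (a (c k)).2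

theorem ne_of_finrank_direction_segment {u v : Fin n → ℝ}
    (h : Module.finrank ℝ (affineSpan ℝ (segment ℝ u v)).direction = 1) : u ≠ v := by
  rintro rfl
  rw [direction_affineSpan, vectorSpan_segment, vsub_self, Submodule.span_zero_singleton,
    finrank_bot] at h
  exact zero_ne_one h

/-- Two vertices are joined by an edge if all constraints but one of a system determining the first
are active at the second. -/
theorem isFaceOfDim_segment {u v : Fin n → ℝ} (hu : u ∈ polyhedron A b) (hv : v ∈ polyhedron A b)
    (f : κ → ι) (hf : ∀ d : Fin n → ℝ, (∀ k, (A *ᵥ d) (f k) = 0) → d = 0)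
    (huf : ∀ k, (A *ᵥ u) (f k) = b (f k)) (k₀ : κ)
    (hvf : ∀ k, k ≠ k₀ → (A *ᵥ v) (f k) = b (f k))
    (j : ι) (huj : (A *ᵥ u) j ≠ b j) (hvj : (A *ᵥ v) j = b j) :
    IsFaceOfDim (polyhedron A b) (segment ℝ u v) 1 := by
  have hne : u ≠ v := fun h => huj (h ▸ hvj)
  have hvk : (A *ᵥ v) (f k₀) - b (f k₀) ≠ 0 := fun h => hne <| sub_eq_zero.1 <| hf _ fun k => by
    by_cases hk : k = k₀
    · subst hk; simp [mulVec_sub, huf, sub_eq_zero.1 h]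
    · simp [mulVec_sub, huf, hvf k hk]
  have hseg : segment ℝ u v =
      {x | x ∈ polyhedron A b ∧ ∀ k ∈ {k | k ≠ k₀}, (A *ᵥ x) (f k) = b (f k)} := by
    ext x
    constructor
    · rintro ⟨α, β, hα, hβ, hαβ, rfl⟩
      refine ⟨fun i => ?_, fun k hk => ?_⟩
      · have := mul_le_mul_of_nonneg_left (hu i) hα
        have := mul_le_mul_of_nonneg_left (hv i) hβ
        have : (α + β) * b i = b i := by rw [hαβ, one_mul]
        simp only [mulVec_add, mulVec_smul, Pi.add_apply, Pi.smul_apply, smul_eq_mul]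
        linarith
      · simp [mulVec_add, mulVec_smul, huf, hvf k hk, ← add_mul, hαβ]
    · rintro ⟨hx, hxf⟩
      set t := ((A *ᵥ x) (f k₀) - b (f k₀)) / ((A *ᵥ v) (f k₀) - b (f k₀)) with ht
      have hxt : x - u - t • (v - u) = 0 := hf _ fun k => by
        by_cases hk : k = k₀
        · subst hk
          simp only [mulVec_sub, mulVec_smul, huf, Pi.sub_apply, Pi.smul_apply, smul_eq_mul, ht]
          field_simp
          simp
        · simp [mulVec_sub, mulVec_smul, huf, hvf k hk, hxf k hk]
      have ht0 : 0 ≤ t := div_nonneg (sub_nonneg.2 (hx _)) (sub_nonneg.2 (hv _))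
      have hx' : x = (1 - t) • u + t • v := by
        linear_combination (norm := module) hxt
      have ht1 : 0 ≤ 1 - t := by
        have h := hx j
        simp only [hx', mulVec_add, mulVec_smul, Pi.add_apply, Pi.smul_apply, smul_eq_mul, hvj] at h
        refine nonneg_of_mul_nonneg_left (b := (A *ᵥ u) j - b j) (by linarith) ?_
        exact sub_pos.2 (lt_of_le_of_ne (hu j) huj.symm)
      exact ⟨1 - t, t, ht1, ht0, by ring, hx'.symm⟩
  refine ⟨⟨u, left_mem_segment ℝ u v⟩, convex_segment u v, ?_, ?_⟩
  · rw [hseg]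
    exact isExtreme_polyhedron_face f _
  · rw [direction_affineSpan, vectorSpan_segment]
    exact finrank_span_singleton (sub_ne_zero.2 hne.symm)

/-- At least `n - 1` constraints are active along an edge of a polyhedron in dimension `n`. -/
theorem le_card_succ_of_isFaceOfDim [Finite ι] {u v : Fin n → ℝ}
    (h : IsFaceOfDim (polyhedron A b) (segment ℝ u v) 1) (s : Finset ι)
    (hs : ∀ i, (A *ᵥ u) i = b i → (A *ᵥ v) i = b i → i ∈ s) : n ≤ s.card + 1 := by
  obtain ⟨-, -, hext, hdim⟩ := h
  have hu := hext.subset (left_mem_segment ℝ u v)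
  have hv := hext.subset (right_mem_segment ℝ u v)
  let B : Matrix s (Fin n) ℝ := A.submatrix Subtype.val id
  let m : Fin n → ℝ := (1 / 2 : ℝ) • u + (1 / 2 : ℝ) • v
  have hm : m ∈ segment ℝ u v := ⟨1 / 2, 1 / 2, by norm_num, by norm_num, by norm_num, rfl⟩
  have hle : LinearMap.ker B.mulVecLin ≤ Submodule.span ℝ {v - u} := by
    intro d hd
    obtain ⟨t, ht, h₁, h₂⟩ := exists_pos_add_smul_mem_polyhedron (d := d) (hext.subset hm) fun i hi => by
      have hui := hu i
      have hvi := hv i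
      simp only [m, mulVec_add, mulVec_smul, Pi.add_apply, Pi.smul_apply, smul_eq_mul] at hi
      exact congr_fun (LinearMap.mem_ker.1 hd) ⟨i, hs i (by linarith) (by linarith)⟩
    obtain ⟨α, β, -, -, hαβ, hd'⟩ := hext.left_mem_of_mem_openSegment h₁ h₂ hm
      ⟨1 / 2, 1 / 2, by norm_num, by norm_num, by norm_num, by module⟩
    refine Submodule.mem_span_singleton.2 ⟨t⁻¹ * (β - 1 / 2), ?_⟩
    obtain rfl : α = 1 - β := by linarith
    rw [mul_smul, inv_smul_eq_iff₀ ht.ne']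
    simp only [m] at hd'
    linear_combination (norm := module) hd'
  have h₁ : Module.finrank ℝ (LinearMap.ker B.mulVecLin) ≤ 1 := by
    rw [direction_affineSpan, vectorSpan_segment] at hdim
    exact (Submodule.finrank_mono hle).trans hdim.le
  have h₂ : Module.finrank ℝ (LinearMap.range B.mulVecLin) ≤ s.card := by
    simpa using Submodule.finrank_le (LinearMap.range B.mulVecLin)
  have := B.mulVecLin.finrank_range_add_finrank_ker
  simp only [Module.finrank_fin_fun] at this
  omega

end Polyhedron

section EdgeWalk

variable {n : ℕ} {P : Set (Fin n → ℝ)}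

theorem isEdgeWalk_zero_iff {u v : Fin n → ℝ} :
    IsEdgeWalk P 0 u v ↔ u ∈ Set.extremePoints ℝ P ∧ u = v := by
  constructor
  · rintro ⟨y, rfl, rfl, hy, -⟩
    exact ⟨hy _, rfl⟩
  · rintro ⟨hu, rfl⟩
    exact ⟨fun _ => u, rfl, rfl, fun _ => hu, fun i => i.elim0⟩

theorem isEdgeWalk_succ_iff {k : ℕ} {u v : Fin n → ℝ} :
    IsEdgeWalk P (k + 1) u v ↔ u ∈ Set.extremePoints ℝ P ∧
      ∃ w, IsFaceOfDim P (segment ℝ u w) 1 ∧ IsEdgeWalk P k w v := by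
  constructor
  · rintro ⟨y, rfl, rfl, hy, he⟩
    exact ⟨hy 0, y 1, he 0, fun i => y i.succ, rfl, rfl, fun i => hy _, fun i => he i.succ⟩
  · rintro ⟨hu, w, huw, y, rfl, rfl, hy, he⟩
    refine ⟨Fin.cons u y, rfl, rfl, Fin.cases hu hy, Fin.cases huw fun i => ?_⟩
    simpa using he i

theorem IsEdgeWalk.left_mem {k : ℕ} {u v : Fin n → ℝ} (h : IsEdgeWalk P k u v) :
    u ∈ Set.extremePoints ℝ P := by
  obtain ⟨y, rfl, -, hy, -⟩ := h
  exact hy 0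

end EdgeWalk

/-- Laplace expansion of a determinant along its first two rows. -/
def laplaceDet (M : Matrix (Fin 4) (Fin 4) ℤ) : ℤ :=
  (M 0 0 * M 1 1 - M 0 1 * M 1 0) * (M 2 2 * M 3 3 - M 2 3 * M 3 2) -
  (M 0 0 * M 1 2 - M 0 2 * M 1 0) * (M 2 1 * M 3 3 - M 2 3 * M 3 1) +
  (M 0 0 * M 1 3 - M 0 3 * M 1 0) * (M 2 1 * M 3 2 - M 2 2 * M 3 1) +
  (M 0 1 * M 1 2 - M 0 2 * M 1 1) * (M 2 0 * M 3 3 - M 2 3 * M 3 0) -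
  (M 0 1 * M 1 3 - M 0 3 * M 1 1) * (M 2 0 * M 3 2 - M 2 2 * M 3 0) +
  (M 0 2 * M 1 3 - M 0 3 * M 1 2) * (M 2 0 * M 3 1 - M 2 1 * M 3 0)

theorem laplaceDet_eq_det (M : Matrix (Fin 4) (Fin 4) ℤ) : laplaceDet M = M.det := by
  simp [laplaceDet, det_succ_row_zero, Fin.sum_univ_succ, Fin.succAbove]
  ring

/-- The matrix `AQ` with integer entries. -/
def intQ : Matrix (Fin 9) (Fin 4) ℤ :=
  !![3, -3, -1, -2;
     -3, 3, -1, -2;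
     -2, 1, -1, -3;
     2, -1, -1, -3;
     -3, -3, 1, -2;
     3, 3, 1, -2;
     1, 2, 1, -3;
     -1, -2, 1, -3;
     0, 0, 0, 2]

theorem AQ_eq_map : AQ = intQ.map (Int.castRingHom ℝ) := by
  ext i j
  fin_cases i <;> fin_cases j <;> simp [AQ, intQ]

/-- The determinant of the system of the constraints `f`. -/
def rowsDet (f : Fin 4 → Fin 9) : ℤ := laplaceDet (intQ.submatrix f id)

/-- The numerators in Cramer's rule for the system of the constraints `f`. -/
def cramerNum (f : Fin 4 → Fin 9) (k : Fin 4) : ℤ :=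
  laplaceDet ((intQ.submatrix f id).updateCol k fun _ => -1)

/-- The point at which the constraints `f` are active. -/
def basicPoint (f : Fin 4 → Fin 9) : Fin 4 → ℝ := fun k => cramerNum f k / rowsDet f

/-- The slack of the constraint `i` at `basicPoint f`, multiplied by `rowsDet f ^ 2`. -/
def scaledSlack (f : Fin 4 → Fin 9) (i : Fin 9) : ℤ :=
  rowsDet f * (intQ i 0 * cramerNum f 0 + intQ i 1 * cramerNum f 1 + intQ i 2 * cramerNum f 2 +
    intQ i 3 * cramerNum f 3 + rowsDet f)

theorem scaledSlack_eq {f : Fin 4 → Fin 9} (hf : rowsDet f ≠ 0) (i : Fin 9) :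
    (scaledSlack f i : ℝ) = (rowsDet f : ℝ) ^ 2 * ((AQ *ᵥ basicPoint f) i - bQ i) := by
  have : (rowsDet f : ℝ) ≠ 0 := by exact_mod_cast hf
  simp only [AQ_eq_map, scaledSlack, mulVec, dotProduct, Fin.sum_univ_four, basicPoint, bQ, map_apply,
    Int.coe_castRingHom]
  push_cast
  field_simp
  ring

theorem det_submatrix_AQ (f : Fin 4 → Fin 9) : (AQ.submatrix f id).det = rowsDet f := by
  rw [rowsDet, laplaceDet_eq_det, AQ_eq_map]
  exact ((Int.castRingHom ℝ).map_det _).symm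

theorem eq_basicPoint {f : Fin 4 → Fin 9} (hf : rowsDet f ≠ 0) {x : Fin 4 → ℝ}
    (hx : ∀ k, (AQ *ᵥ x) (f k) = bQ (f k)) : x = basicPoint f := by
  have hf' : (rowsDet f : ℝ) ≠ 0 := by exact_mod_cast hf
  have hx' : AQ.submatrix f id *ᵥ x = fun _ => -1 := funext hx
  ext k
  have h : (AQ.submatrix f id).cramer (fun _ => -1) k = rowsDet f * x k := by
    rw [cramer_eq_adjugate_mulVec, ← hx', mulVec_mulVec, adjugate_mul, smul_mulVec, one_mulVec,
      det_submatrix_AQ, Pi.smul_apply, smul_eq_mul]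
  have h' : (AQ.submatrix f id).cramer (fun _ => -1) k = cramerNum f k := by
    rw [cramer_apply, cramerNum, laplaceDet_eq_det, AQ_eq_map]
    refine Eq.trans ?_ ((Int.castRingHom ℝ).map_det _).symm
    congr 1
    ext i j
    by_cases hj : j = k <;> simp [hj]
  rw [basicPoint, eq_div_iff hf', ← h', h, mul_comm]

/-- The constraints active at each of the 27 vertices of `polyQ`. -/
def vertexRows : Fin 27 → Fin 4 → Fin 9 :=
  ![![0, 1, 2, 3], ![0, 1, 2, 8], ![0, 1, 3, 8], ![0, 2, 3, 4], ![0, 2, 4, 8], ![0, 3, 4, 7],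
    ![0, 3, 5, 6], ![0, 3, 5, 8], ![0, 3, 6, 7], ![0, 4, 7, 8], ![0, 5, 6, 7], ![0, 5, 7, 8],
    ![1, 2, 3, 5], ![1, 2, 4, 7], ![1, 2, 4, 8], ![1, 2, 5, 6], ![1, 2, 6, 7], ![1, 3, 5, 8],
    ![1, 4, 6, 7], ![1, 4, 6, 8], ![1, 5, 6, 8], ![2, 3, 4, 7], ![2, 3, 5, 6], ![2, 3, 6, 7],
    ![4, 5, 6, 7], ![4, 5, 6, 8], ![4, 5, 7, 8]]

/-- The adjacency lists of the graph of `polyQ`. -/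
def neighbors : Fin 27 → List (Fin 27) :=
  ![[1, 2, 3, 12], [0, 2, 4, 14], [0, 1, 7, 17], [0, 4, 5, 21], [1, 3, 9, 14], [3, 8, 9, 21],
    [7, 8, 10, 22], [2, 6, 11, 17], [5, 6, 10, 23], [4, 5, 11, 26], [6, 8, 11, 24], [7, 9, 10, 26],
    [0, 15, 17, 22], [14, 16, 18, 21], [1, 4, 13, 19], [12, 16, 20, 22], [13, 15, 18, 23], [2, 7, 12, 20],
    [13, 16, 19, 24], [14, 18, 20, 25], [15, 17, 19, 25], [3, 5, 13, 23], [6, 12, 15, 23], [8, 16, 21, 22],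
    [10, 18, 25, 26], [19, 20, 24, 26], [9, 11, 24, 25]]

theorem rowsDet_vertexRows_ne_zero : ∀ v, rowsDet (vertexRows v) ≠ 0 := by
  decide +kernel

theorem scaledSlack_vertexRows : ∀ v i, 0 ≤ scaledSlack (vertexRows v) i ∧
    (scaledSlack (vertexRows v) i = 0 ↔ ∃ k, vertexRows v k = i) := by
  decide +kernel

theorem exists_vertexRows_eq_or_scaledSlack_neg : ∀ i j, i < j → ∀ k, j < k → ∀ l, k < l →
    rowsDet ![i, j, k, l] ≠ 0 →
    (∃ v, vertexRows v = ![i, j, k, l]) ∨ ∃ a, scaledSlack ![i, j, k, l] a < 0 := by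
  decide +kernel

theorem exists_active_of_mem_neighbors : ∀ u, ∀ v ∈ neighbors u,
    (∃ k, ∀ l, l ≠ k → ∃ a, vertexRows v a = vertexRows u l) ∧
      ∃ a, ∀ l, vertexRows u l ≠ vertexRows v a := by
  decide +kernel

theorem mem_neighbors_of_le_card : ∀ u v,
    3 ≤ (Finset.univ.filter fun i : Fin 9 =>
      (∃ k, vertexRows u k = i) ∧ ∃ l, vertexRows v l = i).card → u = v ∨ v ∈ neighbors u := by
  decide +kernel

theorem eq_of_vertexRows_subset : ∀ u v,
    (∀ k, ∃ l, vertexRows v l = vertexRows u k) → u = v := by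
  decide +kernel

/-- Whether `v` can be reached from `u` in at most `k` steps along `neighbors`. -/
def reach : ℕ → Fin 27 → Fin 27 → Bool
  | 0, u, v => u == v
  | k + 1, u, v => u == v || (neighbors u).any fun w => reach k w v

theorem reach_five : ∀ u v, reach 5 u v := by
  decide +kernel

/-- The vertices of `polyQ`. -/
def vertex (v : Fin 27) : Fin 4 → ℝ := basicPoint (vertexRows v)

theorem sq_rowsDet_vertexRows_pos (v : Fin 27) : 0 < (rowsDet (vertexRows v) : ℝ) ^ 2 := by
  have := rowsDet_vertexRows_ne_zero v
  positivity

theorem vertex_mem (v : Fin 27) : vertex v ∈ polyhedron AQ bQ := by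
  intro i
  have h : (0 : ℝ) ≤ scaledSlack (vertexRows v) i := by
    exact_mod_cast (scaledSlack_vertexRows v i).1
  rw [scaledSlack_eq (rowsDet_vertexRows_ne_zero v)] at h
  exact sub_nonneg.1 (nonneg_of_mul_nonneg_right h (sq_rowsDet_vertexRows_pos v))

theorem vertex_active_iff (v : Fin 27) (i : Fin 9) :
    (AQ *ᵥ vertex v) i = bQ i ↔ ∃ k, vertexRows v k = i := by
  rw [← (scaledSlack_vertexRows v i).2, ← Int.cast_eq_zero (α := ℝ),
    scaledSlack_eq (rowsDet_vertexRows_ne_zero v), mul_eq_zero, sub_eq_zero]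
  simp [(sq_rowsDet_vertexRows_pos v).ne', vertex]

theorem eq_zero_of_mulVec_vertexRows (v : Fin 27) (d : Fin 4 → ℝ)
    (hd : ∀ k, (AQ *ᵥ d) (vertexRows v k) = 0) : d = 0 := by
  refine eq_zero_of_mulVec_eq_zero (M := AQ.submatrix (vertexRows v) id) ?_ (funext hd)
  rw [det_submatrix_AQ]
  exact_mod_cast rowsDet_vertexRows_ne_zero v

theorem vertex_active (v : Fin 27) (k : Fin 4) :
    (AQ *ᵥ vertex v) (vertexRows v k) = bQ (vertexRows v k) :=
  (vertex_active_iff v _).2 ⟨k, rfl⟩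

theorem extremePoints_polyQ : Set.extremePoints ℝ polyQ = Set.range vertex := by
  apply subset_antisymm
  · intro x hx
    obtain ⟨f, hf, hdet, hxf⟩ := exists_strictMono_det_ne_zero (A := AQ) (b := bQ) hx
    have hdet' : rowsDet f ≠ 0 := by
      rw [det_submatrix_AQ] at hdet
      exact_mod_cast hdet
    obtain rfl := eq_basicPoint hdet' hxf
    have hff : f = ![f 0, f 1, f 2, f 3] := by
      ext k
      fin_cases k <;> rfl
    rcases exists_vertexRows_eq_or_scaledSlack_neg (f 0) (f 1) (hf (by decide)) (f 2)
      (hf (by decide)) (f 3) (hf (by decide)) (hff ▸ hdet') with ⟨v, hv⟩ | ⟨a, ha⟩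
    · exact ⟨v, by rw [vertex, hv, ← hff]⟩
    · rw [← hff] at ha
      have h : (scaledSlack f a : ℝ) < 0 := by exact_mod_cast ha
      rw [scaledSlack_eq hdet'] at h
      exact absurd h (not_lt.2 (mul_nonneg (sq_nonneg _) (sub_nonneg.2 (hx.1 a))))
  · rintro _ ⟨v, rfl⟩
    exact mem_extremePoints_polyhedron (vertex_mem v) (vertexRows v) (vertex_active v)
      (eq_zero_of_mulVec_vertexRows v)

theorem isFaceOfDim_of_mem_neighbors {u v : Fin 27} (h : v ∈ neighbors u) :
    IsFaceOfDim polyQ (segment ℝ (vertex u) (vertex v)) 1 := by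
  obtain ⟨⟨k, hk⟩, a, ha⟩ := exists_active_of_mem_neighbors u v h
  refine isFaceOfDim_segment (vertex_mem u) (vertex_mem v) (vertexRows u)
    (eq_zero_of_mulVec_vertexRows u) (vertex_active u) k
    (fun l hl => (vertex_active_iff v _).2 (hk l hl)) (vertexRows v a) ?_ (vertex_active v a)
  rw [Ne, vertex_active_iff, not_exists]
  exact ha

theorem mem_neighbors_of_isFaceOfDim {u v : Fin 27}
    (h : IsFaceOfDim polyQ (segment ℝ (vertex u) (vertex v)) 1) : v ∈ neighbors u := by
  refine (mem_neighbors_of_le_card u v ?_).resolve_left fun huv =>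
    ne_of_finrank_direction_segment h.2.2.2 (huv ▸ rfl)
  refine Nat.le_of_succ_le_succ (le_card_succ_of_isFaceOfDim (A := AQ) (b := bQ) h _ fun i hu hv => ?_)
  rw [vertex_active_iff] at hu hv
  simp [hu, hv]

theorem vertex_injective : Function.Injective vertex := by
  intro u v h
  exact eq_of_vertexRows_subset u v fun k => (vertex_active_iff v _).1 (h ▸ vertex_active u k)

theorem exists_isEdgeWalk_of_reach {k : ℕ} {u v : Fin 27} (h : reach k u v) :
    ∃ j ≤ k, IsEdgeWalk polyQ j (vertex u) (vertex v) := by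
  have hext (w : Fin 27) : vertex w ∈ Set.extremePoints ℝ polyQ :=
    extremePoints_polyQ ▸ Set.mem_range_self w
  induction k generalizing u with
  | zero =>
    simp only [reach, beq_iff_eq] at h
    exact ⟨0, le_rfl, isEdgeWalk_zero_iff.2 ⟨hext u, h ▸ rfl⟩⟩
  | succ k ih =>
    simp only [reach, Bool.or_eq_true, beq_iff_eq, List.any_eq_true] at h
    rcases h with rfl | ⟨w, hw, h⟩
    · exact ⟨0, Nat.zero_le _, isEdgeWalk_zero_iff.2 ⟨hext u, rfl⟩⟩
    · obtain ⟨j, hj, hwalk⟩ := ih h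
      exact ⟨j + 1, Nat.succ_le_succ hj,
        isEdgeWalk_succ_iff.2 ⟨hext u, _, isFaceOfDim_of_mem_neighbors hw, hwalk⟩⟩

theorem reach_of_isEdgeWalk {k : ℕ} {u v : Fin 27}
    (h : IsEdgeWalk polyQ k (vertex u) (vertex v)) : reach k u v := by
  induction k generalizing u with
  | zero => simpa [reach] using vertex_injective (isEdgeWalk_zero_iff.1 h).2
  | succ k ih =>
    obtain ⟨-, w, huw, hwalk⟩ := isEdgeWalk_succ_iff.1 h
    obtain ⟨w, rfl⟩ := extremePoints_polyQ ▸ hwalk.left_mem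
    simp only [reach, Bool.or_eq_true, List.any_eq_true]
    exact Or.inr ⟨w, mem_neighbors_of_isFaceOfDim huw, ih hwalk⟩

theorem isBounded_polyQ : Bornology.IsBounded polyQ := by
  refine (Metric.isBounded_Icc (fun _ => -4) fun _ => 4).subset fun x hx => ?_
  have h0 := hx 0
  have h1 := hx 1
  have h4 := hx 4
  have h5 := hx 5
  have h8 := hx 8
  simp [AQ, bQ, mulVec, dotProduct, Fin.sum_univ_four] at h0 h1 h4 h5 h8
  constructor <;> intro k <;> fin_cases k <;> simp <;> linarith

theorem finrank_direction_polyQ : Module.finrank ℝ (affineSpan ℝ polyQ).direction = 4 := by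
  have hopen : IsOpen {x : Fin 4 → ℝ | ∀ i, bQ i < (AQ *ᵥ x) i} := by
    simp only [Set.ofPred_forall]
    exact isOpen_iInter_of_finite fun i => isOpen_lt continuous_const (by fun_prop)
  have hspan : affineSpan ℝ {x : Fin 4 → ℝ | ∀ i, bQ i < (AQ *ᵥ x) i} = ⊤ :=
    hopen.affineSpan_eq_top ⟨0, fun i => by simp [bQ]⟩
  have : affineSpan ℝ polyQ = ⊤ :=
    top_le_iff.1 (hspan ▸ affineSpan_mono ℝ fun x hx i => (hx i).le)
  rw [this, AffineSubspace.direction_top, finrank_top, Module.finrank_fin_fun]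

/-- The Klee–Walkup polytope realization `Q̃₄ = {x ∈ ℝ⁴ : A_Q x ≥ b_Q}` is a 4-dimensional
polytope with exactly 27 vertices, and its graph diameter equals 5: every pair of vertices is
joined by an edge walk of length at most 5, and some pair of vertices admits no edge walk of
length less than 5. -/
theorem Q4_dim_vertices_graph_diameter :
    Bornology.IsBounded polyQ ∧
    Module.finrank ℝ (affineSpan ℝ polyQ).direction = 4 ∧
    (Set.extremePoints ℝ polyQ).ncard = 27 ∧
    (∀ u v : Fin 4 → ℝ, u ∈ Set.extremePoints ℝ polyQ → v ∈ Set.extremePoints ℝ polyQ →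
      ∃ k ≤ 5, IsEdgeWalk polyQ k u v) ∧
    (∃ u v : Fin 4 → ℝ, u ∈ Set.extremePoints ℝ polyQ ∧ v ∈ Set.extremePoints ℝ polyQ ∧
      ∀ k : ℕ, IsEdgeWalk polyQ k u v → 5 ≤ k) := by
  refine ⟨isBounded_polyQ, finrank_direction_polyQ, ?_, ?_, vertex 0, vertex 24, ?_, ?_, ?_⟩
  · rw [extremePoints_polyQ, Set.ncard_range_of_injective vertex_injective, Nat.card_fin]
  · rw [extremePoints_polyQ]
    rintro _ _ ⟨u, rfl⟩ ⟨v, rfl⟩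
    exact exists_isEdgeWalk_of_reach (reach_five u v)
  · exact extremePoints_polyQ ▸ Set.mem_range_self _
  · exact extremePoints_polyQ ▸ Set.mem_range_self _
  · intro k hk
    have := reach_of_isEdgeWalk hk
    by_contra! hlt
    interval_cases k <;> revert this <;> decide +kernel
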